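/- Let p ∈ (0,1) and let (G_t)_{t≥1} be the preferential attachment process with edge-steps with parameter p. For vertex indices i < j and a time s, let g^{i,j}_s be the indicator of the event that at step s an edge joining vertices i and j is added by an edge-step. Then there exists a constant C > 0, depending only on p, such that for all t ≥ 2, all vertex indices 1 ≤ i < j < k ≤ t, and all times s₁, s₂, s₃ ≤ t: E[ g^{i,j}_{s₁} · g^{i,k}_{s₂} · g^{j,k}_{s₃} ] ≤ C · (log t)⁶ · (i·j·k)^{−(2−p)} · (s₁·s₂·s₃)^{−p} + C · t^{−10}. -/

import Mathlib

open MeasureTheory Filter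

attribute [local instance] Classical.propDecidable

/-- Degree of vertex `i` at time `t` computed from the endpoint process `ep`:
the edge added at step `s` contributes `1` for each of its endpoints equal to `i`
(so a loop at `i` contributes `2`). -/
noncomputable def degOf {Ω : Type} (ep : ℕ → Ω → ℕ × ℕ) (t i : ℕ) (ω : Ω) : ℕ :=
  ∑ s ∈ Finset.Icc 1 t,
    ((if (ep s ω).1 = i then 1 else 0) + (if (ep s ω).2 = i then 1 else 0))

/-- The preferential attachment random graph process with edge-steps and parameter `p`.
`G_1` is a single vertex (labeled `1`) with a loop.  At each step `t + 1` (for `t ≥ 1`),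
with probability `p` a vertex-step occurs: a new vertex `nv t + 1` is added together with an
edge to an old vertex `u`, chosen with probability `d_t(u) / (2t)`; with probability `1 - p`
an edge-step occurs: an edge `{u, w}` is added, where `u` and `w` are chosen independently,
each with probability proportional to its degree.  The field `ep t` records the (ordered pair
of) endpoints of the unique edge added at step `t`, `nv t` is the number of vertices of `G_t`,
and `Z t` tells whether step `t` was a vertex-step.  The one-step conditional laws are
prescribed via conditional expectations with respect to a filtration `ℱ` to which the process
is adapted. -/
structure PAProcess (p : ℝ) where
  Ω : Type
  m0 : MeasurableSpace Ω
  μ : Measure Ω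
  isProb : IsProbabilityMeasure μ
  ℱ : Filtration ℕ m0
  Z : ℕ → Ω → Bool
  nv : ℕ → Ω → ℕ
  ep : ℕ → Ω → ℕ × ℕ
  nv_one : ∀ ω, nv 1 ω = 1
  ep_one : ∀ ω, ep 1 ω = (1, 1)
  nv_succ : ∀ t, 1 ≤ t → ∀ ω, nv (t + 1) ω = nv t ω + (if Z (t + 1) ω then 1 else 0)
  ep_vertexStep : ∀ t, 1 ≤ t → ∀ ω, Z (t + 1) ω = true →
    (ep (t + 1) ω).2 = nv t ω + 1 ∧ 1 ≤ (ep (t + 1) ω).1 ∧ (ep (t + 1) ω).1 ≤ nv t ω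
  ep_edgeStep : ∀ t, 1 ≤ t → ∀ ω, Z (t + 1) ω = false →
    1 ≤ (ep (t + 1) ω).1 ∧ (ep (t + 1) ω).1 ≤ nv t ω ∧
    1 ≤ (ep (t + 1) ω).2 ∧ (ep (t + 1) ω).2 ≤ nv t ω
  Z_meas : ∀ t, Measurable[ℱ t] (Z t)
  nv_meas : ∀ t, Measurable[ℱ t] (nv t)
  ep_meas : ∀ t, Measurable[ℱ t] (ep t)
  condLaw_Z : ∀ t, 1 ≤ t →
    μ[Set.indicator {ω | Z (t + 1) ω = true} (fun _ => (1 : ℝ)) | ℱ t] =ᵐ[μ] fun _ => p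
  condLaw_vertex : ∀ t, 1 ≤ t → ∀ u,
    μ[Set.indicator {ω | Z (t + 1) ω = true ∧ ep (t + 1) ω = (u, nv t ω + 1)}
        (fun _ => (1 : ℝ)) | ℱ t]
      =ᵐ[μ] fun ω => p * (degOf ep t u ω : ℝ) / (2 * t)
  condLaw_edge : ∀ t, 1 ≤ t → ∀ u w,
    μ[Set.indicator {ω | Z (t + 1) ω = false ∧ ep (t + 1) ω = (u, w)}
        (fun _ => (1 : ℝ)) | ℱ t]
      =ᵐ[μ] fun ω => (1 - p) * (degOf ep t u ω : ℝ) * (degOf ep t w ω : ℝ) / (2 * t) ^ 2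

namespace PAProcess

variable {p : ℝ} (P : PAProcess p)

/-- degree `d_t(i)` of vertex `i` in `G_t` (`0` if `i` is not yet present). -/
noncomputable def deg (t i : ℕ) (ω : P.Ω) : ℕ := degOf P.ep t i ω

/-- `i` and `j` are joined by at least one edge in `G_t`. -/
def Joined (t i j : ℕ) (ω : P.Ω) : Prop :=
  ∃ s ∈ Finset.Icc 1 t, P.ep s ω = (i, j) ∨ P.ep s ω = (j, i)

/-- number of triangles of `G_t`: sets of three distinct vertices pairwise joined by at
least one edge (counted without edge multiplicities). -/
noncomputable def triangles (t : ℕ) (ω : P.Ω) : ℕ :=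
  ((Finset.Icc 1 t ×ˢ Finset.Icc 1 t ×ˢ Finset.Icc 1 t).filter
    (fun q => q.1 < q.2.1 ∧ q.2.1 < q.2.2 ∧ P.Joined t q.1 q.2.1 ω ∧
      P.Joined t q.1 q.2.2 ω ∧ P.Joined t q.2.1 q.2.2 ω)).card

/-- number of cherries (paths of length 2) of `G_t`: unordered pairs of distinct edges of
`G_t` sharing a common endpoint.  The edges of `G_t` are indexed by their creation times
`1 ≤ s ≤ t`. -/
noncomputable def cherries (t : ℕ) (ω : P.Ω) : ℕ :=
  ((Finset.Icc 1 t ×ˢ Finset.Icc 1 t).filter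
    (fun q => q.1 < q.2 ∧
      ((P.ep q.1 ω).1 = (P.ep q.2 ω).1 ∨ (P.ep q.1 ω).1 = (P.ep q.2 ω).2 ∨
       (P.ep q.1 ω).2 = (P.ep q.2 ω).1 ∨ (P.ep q.1 ω).2 = (P.ep q.2 ω).2))).card

/-- global clustering coefficient of `G_t`. -/
noncomputable def clustering (t : ℕ) (ω : P.Ω) : ℝ :=
  3 * (P.triangles t ω : ℝ) / (P.cherries t ω : ℝ)

/-- clique number of `G_t`: the largest `k` such that `G_t` contains `k` distinct vertices
pairwise joined by at least one edge. -/
noncomputable def cliqueNum (t : ℕ) (ω : P.Ω) : ℕ :=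
  sSup {k | ∃ S : Finset ℕ, S ⊆ Finset.Icc 1 (P.nv t ω) ∧ S.card = k ∧
    ∀ i ∈ S, ∀ j ∈ S, i ≠ j → P.Joined t i j ω}

/-- `Γ_t(j)`: the number of distinct vertices joined to `j` by at least one edge in `G_t`. -/
noncomputable def nbrCount (t j : ℕ) (ω : P.Ω) : ℕ :=
  ((Finset.Icc 1 t).filter (fun i => P.Joined t i j ω)).card

/-- the time at which vertex `j` is added to the graph. -/
noncomputable def addTime (j : ℕ) (ω : P.Ω) : ℕ := sInf {t | P.nv t ω = j}

/-- at step `s` an edge joining `i` and `j` is added by an edge-step. -/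
def EdgeStepEdge (s i j : ℕ) (ω : P.Ω) : Prop :=
  2 ≤ s ∧ P.Z s ω = false ∧ (P.ep s ω = (i, j) ∨ P.ep s ω = (j, i))

/-- at step `s` an edge joining `i` and `j` is added by a vertex-step. -/
def VertexStepEdge (s i j : ℕ) (ω : P.Ω) : Prop :=
  2 ≤ s ∧ P.Z s ω = true ∧ (P.ep s ω = (i, j) ∨ P.ep s ω = (j, i))

/-- at step `s` vertex `j` is added by a vertex-step and its attaching edge connects it
to vertex `i`. -/
def AttachEdge (s i j : ℕ) (ω : P.Ω) : Prop :=
  2 ≤ s ∧ P.Z s ω = true ∧ P.ep s ω = (i, j) ∧ P.nv s ω = j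

/-- `i` and `j` are joined in `G_t` by at least one edge created at an edge-step. -/
def EdgeJoined (t i j : ℕ) (ω : P.Ω) : Prop :=
  ∃ s ∈ Finset.Icc 1 t, P.EdgeStepEdge s i j ω

/-- `i` and `j` are joined in `G_t` by at least one edge created at a vertex-step. -/
def VJoined (t i j : ℕ) (ω : P.Ω) : Prop :=
  ∃ s ∈ Finset.Icc 1 t, P.VertexStepEdge s i j ω

/-- `i` and `j` are joined in `G_t`, and exclusively by edges created at vertex-steps. -/
def OnlyVertexJoined (t i j : ℕ) (ω : P.Ω) : Prop :=
  P.Joined t i j ω ∧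
    ∀ s ∈ Finset.Icc 1 t, (P.ep s ω = (i, j) ∨ P.ep s ω = (j, i)) → P.Z s ω = true

end PAProcess

attribute [local instance] PAProcess.m0 PAProcess.isProb

/-- The pull-out property and the tower property combined, for the indicator of an event whose
conditional probability is known. -/
lemma integral_mul_indicator_of_condExp {Ω : Type*} {m m0 : MeasurableSpace Ω} {μ : Measure Ω}
    [IsProbabilityMeasure μ] (hm : m ≤ m0) {E : Set Ω} (hE : MeasurableSet E) {g h : Ω → ℝ}
    (hg : μ[E.indicator (fun _ => (1 : ℝ)) | m] =ᵐ[μ] g) (hh : StronglyMeasurable[m] h) {C : ℝ}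
    (hC : ∀ ω, |h ω| ≤ C) :
    ∫ ω, h ω * E.indicator (fun _ => (1 : ℝ)) ω ∂μ = ∫ ω, h ω * g ω ∂μ := by
  have h_int : Integrable (E.indicator (fun _ => (1 : ℝ))) μ :=
    (integrable_const 1).indicator hE
  have hmul : Integrable (h * E.indicator (fun _ => (1 : ℝ))) μ :=
    h_int.bdd_mul (hh.mono hm).aestronglyMeasurable (ae_of_all _ hC)
  calc ∫ ω, h ω * E.indicator (fun _ => (1 : ℝ)) ω ∂μ
      = ∫ ω, (μ[h * E.indicator (fun _ => (1 : ℝ)) | m]) ω ∂μ := (integral_condExp hm).symm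
    _ = ∫ ω, h ω * g ω ∂μ := by
      refine integral_congr_ae ?_
      filter_upwards [condExp_mul_of_stronglyMeasurable_left hh hmul h_int, hg] with ω h1 h2
      rw [h1, Pi.mul_apply, h2]

namespace PAProcess

variable {p : ℝ} (P : PAProcess p)

lemma deg_zero (v : ℕ) (ω : P.Ω) : P.deg 0 v ω = 0 := by simp [deg, degOf]

lemma deg_succ (s v : ℕ) (ω : P.Ω) :
    P.deg (s + 1) v ω = P.deg s v ω +
      ((if (P.ep (s + 1) ω).1 = v then 1 else 0) + (if (P.ep (s + 1) ω).2 = v then 1 else 0)) := by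
  unfold deg degOf
  rw [Finset.sum_Icc_succ_top (by omega)]

lemma deg_le (s v : ℕ) (ω : P.Ω) : P.deg s v ω ≤ 2 * s := by
  induction s with
  | zero => simp [deg_zero]
  | succ s ih =>
    rw [deg_succ]
    split_ifs <;> omega

lemma sum_deg_le (s : ℕ) (S : Finset ℕ) (ω : P.Ω) : ∑ v ∈ S, P.deg s v ω ≤ 2 * s := by
  induction s with
  | zero => simp [deg_zero]
  | succ s ih =>
    have h (a : ℕ) : ∑ v ∈ S, (if a = v then 1 else 0) ≤ 1 := by
      rw [Finset.sum_ite_eq]; split_ifs <;> omega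
    simp only [deg_succ, Finset.sum_add_distrib]
    have h1 := h (P.ep (s + 1) ω).1
    have h2 := h (P.ep (s + 1) ω).2
    omega

lemma nv_mono_succ {s : ℕ} (hs : 1 ≤ s) (ω : P.Ω) : P.nv s ω ≤ P.nv (s + 1) ω := by
  rw [P.nv_succ s hs]; omega

lemma nv_le {s : ℕ} (hs : 1 ≤ s) (ω : P.Ω) : P.nv s ω ≤ s := by
  induction s, hs using Nat.le_induction with
  | base => rw [P.nv_one]
  | succ s hs ih =>
    rw [P.nv_succ s hs]
    split_ifs <;> omega

lemma ep_le_nv {s : ℕ} (hs : 1 ≤ s) (ω : P.Ω) :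
    (P.ep s ω).1 ≤ P.nv s ω ∧ (P.ep s ω).2 ≤ P.nv s ω := by
  obtain rfl | hs := hs.eq_or_lt
  · simp [P.ep_one, P.nv_one]
  · obtain ⟨s, rfl⟩ : ∃ r, s = r + 1 := ⟨s - 1, by omega⟩
    have h := P.nv_succ s (by omega) ω
    cases hZ : P.Z (s + 1) ω
    · have := P.ep_edgeStep s (by omega) ω hZ
      simp only [hZ] at h
      simp at h
      omega
    · have := P.ep_vertexStep s (by omega) ω hZ
      simp only [hZ] at h
      simp at h
      omega

lemma deg_eq_zero_of_nv_lt {s v : ℕ} (hs : 1 ≤ s) (ω : P.Ω) (hv : P.nv s ω < v) :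
    P.deg s v ω = 0 := by
  induction s, hs using Nat.le_induction with
  | base =>
    rw [P.nv_one] at hv
    rw [deg_succ, deg_zero, P.ep_one, if_neg (by simp; omega)]
  | succ s hs ih =>
    have h1 := P.ep_le_nv (s := s + 1) (by omega) ω
    rw [deg_succ, ih ((P.nv_mono_succ hs ω).trans_lt hv), if_neg (by omega), if_neg (by omega)]

lemma deg_eq_zero_of_lt {s v : ℕ} (ω : P.Ω) (hv : s < v) : P.deg s v ω = 0 := by
  rcases Nat.eq_zero_or_pos s with rfl | hs
  · exact P.deg_zero v ω
  · exact P.deg_eq_zero_of_nv_lt hs ω ((P.nv_le hs ω).trans_lt hv)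

lemma measurable_deg (s v : ℕ) : Measurable[P.ℱ s] (P.deg s v) := by
  unfold deg degOf
  refine Finset.measurable_fun_sum _ fun r hr => ?_
  have hep : Measurable[P.ℱ s] (P.ep r) :=
    (P.ep_meas r).mono (P.ℱ.mono (Finset.mem_Icc.1 hr).2) le_rfl
  exact (Measurable.of_discrete (f := fun q : ℕ × ℕ =>
    (if q.1 = v then 1 else 0) + (if q.2 = v then 1 else 0))).comp hep

lemma measurableSet_edgeEvent (s : ℕ) (q : ℕ × ℕ) :
    MeasurableSet[P.ℱ s] {ω | P.Z s ω = false ∧ P.ep s ω = q} :=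
  (P.Z_meas s (MeasurableSet.singleton false)).inter (P.ep_meas s (MeasurableSet.singleton q))

lemma measurableSet_vertexEvent (s u : ℕ) :
    MeasurableSet {ω | P.Z (s + 1) ω = true ∧ P.ep (s + 1) ω = (u, P.nv s ω + 1)} := by
  have hZ : Measurable (P.Z (s + 1)) := (P.Z_meas (s + 1)).mono (P.ℱ.le _) le_rfl
  have hep : Measurable (P.ep (s + 1)) := (P.ep_meas (s + 1)).mono (P.ℱ.le _) le_rfl
  have hnv : Measurable (P.nv s) := (P.nv_meas s).mono (P.ℱ.le _) le_rfl
  refine (hZ (MeasurableSet.singleton true)).inter (measurableSet_eq_fun hep ?_)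
  exact (Measurable.of_discrete (f := fun n : ℕ => (u, n + 1))).comp hnv

lemma integral_mul_vertexEvent {s : ℕ} (hs : 1 ≤ s) (u : ℕ) {h : P.Ω → ℝ}
    (hh : StronglyMeasurable[P.ℱ s] h) {C : ℝ} (hC : ∀ ω, |h ω| ≤ C) :
    ∫ ω, h ω * Set.indicator {ω | P.Z (s + 1) ω = true ∧ P.ep (s + 1) ω = (u, P.nv s ω + 1)}
        (fun _ => (1 : ℝ)) ω ∂P.μ =
      ∫ ω, h ω * (p * P.deg s u ω / (2 * s)) ∂P.μ :=
  integral_mul_indicator_of_condExp (P.ℱ.le s) (P.measurableSet_vertexEvent s u)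
    (P.condLaw_vertex s hs u) hh hC

lemma integral_mul_edgeEvent {s : ℕ} (hs : 1 ≤ s) (q : ℕ × ℕ) {h : P.Ω → ℝ}
    (hh : StronglyMeasurable[P.ℱ s] h) {C : ℝ} (hC : ∀ ω, |h ω| ≤ C) :
    ∫ ω, h ω * Set.indicator {ω | P.Z (s + 1) ω = false ∧ P.ep (s + 1) ω = q}
        (fun _ => (1 : ℝ)) ω ∂P.μ =
      ∫ ω, h ω * ((1 - p) * P.deg s q.1 ω * P.deg s q.2 ω / (2 * s) ^ 2) ∂P.μ :=
  integral_mul_indicator_of_condExp (P.ℱ.le s) (P.ℱ.le _ _ (P.measurableSet_edgeEvent (s + 1) q))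
    (P.condLaw_edge s hs q.1 q.2) hh hC

/-- The factor, minus one, by which an edge-step with endpoints `q` multiplies
`(1 + y) ^ d(v)`. -/
noncomputable def edgeWeight (y : ℝ) (v : ℕ) (q : ℕ × ℕ) : ℝ :=
  (1 + if q.1 = v then y else 0) * (1 + if q.2 = v then y else 0) - 1

lemma sum_edgeWeight_mul (y : ℝ) (v : ℕ) (S : Finset ℕ) (f : ℕ → ℝ) :
    ∑ q ∈ S ×ˢ S, edgeWeight y v q * (f q.1 * f q.2) =
      (∑ w ∈ S, f w + y * (if v ∈ S then f v else 0)) ^ 2 - (∑ w ∈ S, f w) ^ 2 := by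
  have h : ∑ w ∈ S, (1 + if w = v then y else 0) * f w =
      ∑ w ∈ S, f w + y * (if v ∈ S then f v else 0) := by
    simp [add_mul, Finset.sum_add_distrib, ite_mul]
  rw [← h, sq, sq, Finset.sum_mul_sum, Finset.sum_mul_sum, ← Finset.sum_product',
    ← Finset.sum_product', ← Finset.sum_sub_distrib]
  refine Finset.sum_congr rfl fun q _ => ?_
  unfold edgeWeight
  ring

lemma exp_max_deg_succ_le {s : ℕ} (hs : 1 ≤ s) (v : ℕ) {l : ℝ} (hl : 0 ≤ l) (ω : P.Ω) :
    Real.exp (l * (max (P.deg (s + 1) v ω) 1 : ℕ)) ≤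
      Real.exp (l * (max (P.deg s v ω) 1 : ℕ)) *
        (1 + (Real.exp l - 1) *
            Set.indicator {ω | P.Z (s + 1) ω = true ∧ P.ep (s + 1) ω = (v, P.nv s ω + 1)}
              (fun _ => (1 : ℝ)) ω +
          ∑ q ∈ Finset.Icc 1 s ×ˢ Finset.Icc 1 s, edgeWeight (Real.exp l - 1) v q *
            Set.indicator {ω | P.Z (s + 1) ω = false ∧ P.ep (s + 1) ω = q}
              (fun _ => (1 : ℝ)) ω) := by
  have hy : 0 ≤ Real.exp l - 1 := by linarith [Real.one_le_exp hl]
  have key (a : ℕ) (h : P.deg (s + 1) v ω = P.deg s v ω + a) :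
      Real.exp (l * (max (P.deg (s + 1) v ω) 1 : ℕ)) ≤
        Real.exp (l * (max (P.deg s v ω) 1 : ℕ)) * Real.exp l ^ a := by
    rw [← Real.exp_nat_mul, ← Real.exp_add, Real.exp_le_exp]
    have : ((max (P.deg (s + 1) v ω) 1 : ℕ) : ℝ) ≤ (max (P.deg s v ω) 1 : ℕ) + (a : ℝ) := by
      rw [h]
      exact_mod_cast (by omega)
    nlinarith
  have hdeg := P.deg_succ s v ω
  cases hZ : P.Z (s + 1) ω
  · obtain ⟨h1, h2, h3, h4⟩ := P.ep_edgeStep s hs ω hZ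
    have hnv := P.nv_le hs ω
    rw [Set.indicator_of_notMem (by simp [hZ]), Finset.sum_eq_single (P.ep (s + 1) ω)]
    · rw [Set.indicator_of_mem (by simp [hZ])]
      refine (key _ hdeg).trans_eq ?_
      unfold edgeWeight
      split_ifs <;> ring
    · intro q _ hq
      rw [Set.indicator_of_notMem (by simp [hq.symm]), mul_zero]
    · intro hq
      exact absurd (by simp only [Finset.mem_product, Finset.mem_Icc]; omega) hq
  · obtain ⟨h1, h2, h3⟩ := P.ep_vertexStep s hs ω hZ
    rw [Finset.sum_eq_zero fun q _ => by rw [Set.indicator_of_notMem (by simp [hZ]), mul_zero],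
      add_zero]
    by_cases hv : v = P.nv s ω + 1
    · have h0 : P.deg s v ω = 0 := P.deg_eq_zero_of_nv_lt hs ω (by omega)
      rw [h0, if_neg (by omega), if_pos (by omega)] at hdeg
      rw [hdeg, h0]
      refine le_mul_of_one_le_right (Real.exp_pos _).le (le_add_of_nonneg_right ?_)
      exact mul_nonneg hy (Set.indicator_nonneg (fun _ _ => zero_le_one) _)
    · rw [if_neg (by omega : ¬(P.ep (s + 1) ω).2 = v)] at hdeg
      by_cases hu : (P.ep (s + 1) ω).1 = v
      · rw [Set.indicator_of_mem (by exact ⟨hZ, Prod.ext hu h1⟩)]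
        rw [if_pos hu] at hdeg
        exact (key _ hdeg).trans_eq (by ring)
      · rw [Set.indicator_of_notMem (by exact fun h => hu (congrArg Prod.fst h.2))]
        rw [if_neg hu] at hdeg
        exact (key _ hdeg).trans_eq (by ring)

lemma exp_mul_deg_drift_le (hp0 : 0 ≤ p) (hp1 : p ≤ 1) {s : ℕ} (hs : 1 ≤ s) (v : ℕ) {l l' y : ℝ}
    (hy : 0 ≤ y) (hl' : l + ((2 - p) * y + y ^ 2) / (2 * s) ≤ l') (ω : P.Ω) :
    Real.exp (l * (max (P.deg s v ω) 1 : ℕ)) *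
        (1 + y * (p * P.deg s v ω / (2 * s)) +
          ∑ q ∈ Finset.Icc 1 s ×ˢ Finset.Icc 1 s, edgeWeight y v q *
            ((1 - p) * P.deg s q.1 ω * P.deg s q.2 ω / (2 * s) ^ 2)) ≤
      Real.exp (l' * (max (P.deg s v ω) 1 : ℕ)) := by
  have hs0 : (0 : ℝ) < 2 * s := by positivity
  set d : ℝ := (P.deg s v ω : ℝ)
  set D : ℝ := ((max (P.deg s v ω) 1 : ℕ) : ℝ)
  set T : ℝ := ∑ w ∈ Finset.Icc 1 s, (P.deg s w ω : ℝ)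
  set e : ℝ := if v ∈ Finset.Icc 1 s then d else 0
  have hd : 0 ≤ d := Nat.cast_nonneg _
  have hdD : d ≤ D := by simp only [d, D]; exact_mod_cast le_max_left _ _
  have hds : d ≤ 2 * s := by simp only [d]; exact_mod_cast P.deg_le s v ω
  have hT : T ≤ 2 * s := by simp only [T]; exact_mod_cast P.sum_deg_le s _ ω
  have he0 : 0 ≤ e := by simp only [e]; split_ifs <;> simp [hd]
  have hed : e ≤ d := by simp only [e]; split_ifs <;> simp [hd]
  have hsum : ∑ q ∈ Finset.Icc 1 s ×ˢ Finset.Icc 1 s, edgeWeight y v q *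
      ((1 - p) * P.deg s q.1 ω * P.deg s q.2 ω / (2 * s) ^ 2) =
      (1 - p) * ((T + y * e) ^ 2 - T ^ 2) / (2 * s) ^ 2 := by
    rw [← sum_edgeWeight_mul y v _ (fun w => (P.deg s w ω : ℝ)), Finset.mul_sum, Finset.sum_div]
    exact Finset.sum_congr rfl fun q _ => by ring
  have hq : (T + y * e) ^ 2 - T ^ 2 ≤ (2 * s) * d * (2 * y + y ^ 2) := by
    have h1 : T * (y * e) ≤ 2 * s * (y * d) := by gcongr
    have h2 : e * e ≤ 2 * s * d := by nlinarith
    nlinarith [mul_le_mul_of_nonneg_left h2 (sq_nonneg y)]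
  have hmain : y * (p * d / (2 * s)) + (1 - p) * ((T + y * e) ^ 2 - T ^ 2) / (2 * s) ^ 2 ≤
      ((2 - p) * y + y ^ 2) / (2 * s) * D := by
    calc _ ≤ y * (p * d / (2 * s)) +
          (1 - p) * ((2 * s) * d * (2 * y + y ^ 2)) / (2 * s) ^ 2 := by
          have : 0 ≤ 1 - p := by linarith
          gcongr
      _ = ((2 - p) * y + (1 - p) * y ^ 2) / (2 * s) * d := by field_simp; ring
      _ ≤ ((2 - p) * y + y ^ 2) / (2 * s) * D := by
          have : 0 ≤ 2 - p := by linarith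
          gcongr
          nlinarith [sq_nonneg y]
  rw [hsum]
  calc _ ≤ Real.exp (l * D) * Real.exp (((2 - p) * y + y ^ 2) / (2 * s) * D) := by
        gcongr
        linarith [Real.add_one_le_exp (((2 - p) * y + y ^ 2) / (2 * s) * D)]
    _ ≤ Real.exp (l' * D) := by
        rw [← Real.exp_add, Real.exp_le_exp, ← add_mul]
        gcongr

lemma stronglyMeasurable_exp_mul_max_deg (s v : ℕ) (l : ℝ) :
    StronglyMeasurable[P.ℱ s] fun ω => Real.exp (l * (max (P.deg s v ω) 1 : ℕ)) := by
  refine Measurable.stronglyMeasurable ?_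
  exact (Measurable.of_discrete (f := fun n : ℕ => Real.exp (l * (max n 1 : ℕ)))).comp
    (P.measurable_deg s v)

lemma abs_exp_mul_max_deg_le (s v : ℕ) {l : ℝ} (hl : 0 ≤ l) (ω : P.Ω) :
    |Real.exp (l * (max (P.deg s v ω) 1 : ℕ))| ≤ Real.exp (l * (2 * s + 1 : ℕ)) := by
  rw [Real.abs_exp, Real.exp_le_exp]
  have := P.deg_le s v ω
  gcongr
  omega

lemma integrable_exp_mul_max_deg (s v : ℕ) {l : ℝ} (hl : 0 ≤ l) :
    Integrable (fun ω => Real.exp (l * (max (P.deg s v ω) 1 : ℕ))) P.μ :=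
  Integrable.of_bound
    ((P.stronglyMeasurable_exp_mul_max_deg s v l).mono (P.ℱ.le s)).aestronglyMeasurable _
    (ae_of_all _ (P.abs_exp_mul_max_deg_le s v hl))

/-- One step of the evolution of the exponential moments of a degree. -/
lemma integral_exp_max_deg_succ_le (hp0 : 0 ≤ p) (hp1 : p ≤ 1) {s : ℕ} (hs : 1 ≤ s) (v : ℕ)
    {l l' : ℝ} (hl : 0 ≤ l)
    (hl' : l + ((2 - p) * (Real.exp l - 1) + (Real.exp l - 1) ^ 2) / (2 * s) ≤ l') :
    ∫ ω, Real.exp (l * (max (P.deg (s + 1) v ω) 1 : ℕ)) ∂P.μ ≤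
      ∫ ω, Real.exp (l' * (max (P.deg s v ω) 1 : ℕ)) ∂P.μ := by
  have hy : 0 ≤ Real.exp l - 1 := by linarith [Real.one_le_exp hl]
  have hll' : l ≤ l' := le_trans (le_add_of_nonneg_right (by
    have : 0 ≤ 2 - p := by linarith
    positivity)) hl'
  set y := Real.exp l - 1
  set h : P.Ω → ℝ := fun ω => Real.exp (l * (max (P.deg s v ω) 1 : ℕ))
  have hh := P.stronglyMeasurable_exp_mul_max_deg s v l
  have hC := P.abs_exp_mul_max_deg_le s v hl
  have h_int : Integrable h P.μ := P.integrable_exp_mul_max_deg s v hl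
  have hbdd {g : P.Ω → ℝ} (hg : Integrable g P.μ) : Integrable (fun ω => h ω * g ω) P.μ :=
    hg.bdd_mul (hh.mono (P.ℱ.le s)).aestronglyMeasurable (ae_of_all _ hC)
  have hdeg (w : ℕ) : Measurable fun ω => (P.deg s w ω : ℝ) :=
    (Measurable.of_discrete (f := fun n : ℕ => (n : ℝ))).comp
      ((P.measurable_deg s w).mono (P.ℱ.le s) le_rfl)
  have hdeg_le (w : ℕ) (ω : P.Ω) : (P.deg s w ω : ℝ) ≤ 2 * s := by exact_mod_cast P.deg_le s w ω
  set V : P.Ω → ℝ :=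
    Set.indicator {ω | P.Z (s + 1) ω = true ∧ P.ep (s + 1) ω = (v, P.nv s ω + 1)} fun _ => 1
  set E : ℕ × ℕ → P.Ω → ℝ := fun q =>
    Set.indicator {ω | P.Z (s + 1) ω = false ∧ P.ep (s + 1) ω = q} fun _ => 1
  have hV : Integrable V P.μ := (integrable_const 1).indicator (P.measurableSet_vertexEvent s v)
  have hE (q : ℕ × ℕ) : Integrable (E q) P.μ :=
    (integrable_const 1).indicator (P.ℱ.le _ _ (P.measurableSet_edgeEvent (s + 1) q))
  have hV' : Integrable (fun ω => p * P.deg s v ω / (2 * s)) P.μ := by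
    have : Integrable (fun ω => (P.deg s v ω : ℝ)) P.μ :=
      Integrable.of_bound (hdeg v).aestronglyMeasurable (2 * s) (ae_of_all _ fun ω => by
        rw [Real.norm_natCast]; exact hdeg_le v ω)
    exact (this.const_mul p).div_const _
  have hE' (q : ℕ × ℕ) :
      Integrable (fun ω => (1 - p) * P.deg s q.1 ω * P.deg s q.2 ω / (2 * s) ^ 2) P.μ := by
    have : Integrable (fun ω => (P.deg s q.1 ω : ℝ) * P.deg s q.2 ω) P.μ :=
      Integrable.of_bound ((hdeg q.1).mul (hdeg q.2)).aestronglyMeasurable ((2 * s) * (2 * s))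
        (ae_of_all _ fun ω => by
          rw [norm_mul, Real.norm_natCast, Real.norm_natCast]
          gcongr <;> exact hdeg_le _ ω)
    simpa only [mul_assoc] using (this.const_mul (1 - p)).div_const ((2 * (s : ℝ)) ^ 2)
  have expand (A : P.Ω → ℝ) (B : ℕ × ℕ → P.Ω → ℝ) (ω : P.Ω) :
      h ω * (1 + y * A ω + ∑ q ∈ Finset.Icc 1 s ×ˢ Finset.Icc 1 s, edgeWeight y v q * B q ω) =
        h ω + y * (h ω * A ω) +
          ∑ q ∈ Finset.Icc 1 s ×ˢ Finset.Icc 1 s, edgeWeight y v q * (h ω * B q ω) := by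
    rw [mul_add, Finset.mul_sum]
    congr 1
    · ring
    · exact Finset.sum_congr rfl fun q _ => by ring
  have hint2 (A : P.Ω → ℝ) (B : ℕ × ℕ → P.Ω → ℝ) (hA : Integrable A P.μ)
      (hB : ∀ q, Integrable (B q) P.μ) : Integrable (fun ω => h ω * (1 + y * A ω +
        ∑ q ∈ Finset.Icc 1 s ×ˢ Finset.Icc 1 s, edgeWeight y v q * B q ω)) P.μ := by
    simp_rw [expand]
    exact (h_int.add ((hbdd hA).const_mul y)).add
      (integrable_finsetSum _ fun q _ => (hbdd (hB q)).const_mul _)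
  have hint3 (A : P.Ω → ℝ) (B : ℕ × ℕ → P.Ω → ℝ) (hA : Integrable A P.μ)
      (hB : ∀ q, Integrable (B q) P.μ) : ∫ ω, h ω * (1 + y * A ω +
        ∑ q ∈ Finset.Icc 1 s ×ˢ Finset.Icc 1 s, edgeWeight y v q * B q ω) ∂P.μ =
      ∫ ω, h ω ∂P.μ + y * ∫ ω, h ω * A ω ∂P.μ +
        ∑ q ∈ Finset.Icc 1 s ×ˢ Finset.Icc 1 s,
          edgeWeight y v q * ∫ ω, h ω * B q ω ∂P.μ := by
    have hadd : Integrable (fun ω => h ω + y * (h ω * A ω)) P.μ :=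
      h_int.add ((hbdd hA).const_mul y)
    simp_rw [expand]
    rw [integral_add hadd
        (integrable_finsetSum _ fun q _ => (hbdd (hB q)).const_mul _),
      integral_add h_int ((hbdd hA).const_mul y), integral_const_mul,
      integral_finsetSum _ fun q _ => (hbdd (hB q)).const_mul _]
    simp_rw [integral_const_mul]
  calc ∫ ω, Real.exp (l * (max (P.deg (s + 1) v ω) 1 : ℕ)) ∂P.μ
      ≤ ∫ ω, h ω * (1 + y * V ω +
          ∑ q ∈ Finset.Icc 1 s ×ˢ Finset.Icc 1 s, edgeWeight y v q * E q ω) ∂P.μ :=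
        integral_mono (P.integrable_exp_mul_max_deg (s + 1) v hl) (hint2 V E hV hE)
          (P.exp_max_deg_succ_le hs v hl)
    _ = ∫ ω, h ω * (1 + y * (p * P.deg s v ω / (2 * s)) +
          ∑ q ∈ Finset.Icc 1 s ×ˢ Finset.Icc 1 s, edgeWeight y v q *
            ((1 - p) * P.deg s q.1 ω * P.deg s q.2 ω / (2 * s) ^ 2)) ∂P.μ := by
        rw [hint3 V E hV hE, hint3 (fun ω => p * P.deg s v ω / (2 * s))
          (fun q ω => (1 - p) * P.deg s q.1 ω * P.deg s q.2 ω / (2 * s) ^ 2) hV' hE',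
          P.integral_mul_vertexEvent hs v hh hC]
        congr 1
        exact Finset.sum_congr rfl fun q _ => by rw [P.integral_mul_edgeEvent hs q hh hC]
    _ ≤ _ := integral_mono
        (hint2 (fun ω => p * P.deg s v ω / (2 * s))
          (fun q ω => (1 - p) * P.deg s q.1 ω * P.deg s q.2 ω / (2 * s) ^ 2) hV' hE')
        (P.integrable_exp_mul_max_deg s v (hl.trans hll'))
        (P.exp_mul_deg_drift_le hp0 hp1 hs v hy hl')

/-- The exponential parameter at time `r` for a vertex whose degree is controlled from time `m`
on; it solves, up to an inequality, the recursion of `integral_exp_max_deg_succ_le`. -/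
noncomputable def tilt (α : ℝ) (m r : ℕ) : ℝ :=
  (6 * (((r : ℝ) - 1) / ((m : ℝ) - 1)) ^ α - 5)⁻¹

lemma one_le_ratio_rpow {α : ℝ} (hα : 0 ≤ α) {m r : ℕ} (hm : 2 ≤ m) (hr : m ≤ r) :
    1 ≤ (((r : ℝ) - 1) / ((m : ℝ) - 1)) ^ α := by
  have hm' : (2 : ℝ) ≤ m := by exact_mod_cast hm
  have hr' : (m : ℝ) ≤ r := by exact_mod_cast hr
  refine Real.one_le_rpow ?_ hα
  rw [le_div_iff₀ (by linarith)]
  linarith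

lemma drift_le {l : ℝ} (hp1 : p ≤ 1) (hl0 : 0 ≤ l) (hl1 : l ≤ 1) :
    ((2 - p) * (Real.exp l - 1) + (Real.exp l - 1) ^ 2) / 2 ≤ (1 - p / 2) * (l * (1 + 5 * l)) := by
  have hy0 : 0 ≤ Real.exp l - 1 := by linarith [Real.one_le_exp hl0]
  have hy : Real.exp l - 1 ≤ l + l ^ 2 := by
    have := (abs_le.1 (Real.abs_exp_sub_one_sub_id_le (abs_le.2 ⟨by linarith, hl1⟩))).2
    linarith
  have hsq : (Real.exp l - 1) ^ 2 ≤ 4 * l ^ 2 := by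
    calc (Real.exp l - 1) ^ 2 ≤ (2 * l) ^ 2 := by
          refine pow_le_pow_left₀ hy0 (hy.trans ?_) 2
          nlinarith
      _ = 4 * l ^ 2 := by ring
  nlinarith [mul_le_mul_of_nonneg_left hy (by linarith : 0 ≤ 2 - p),
    mul_nonneg (by linarith : 0 ≤ 1 - p) (sq_nonneg l)]

lemma inv_mul_one_add_le_inv {a b z : ℝ} (ha : 0 < a) (hz : 0 ≤ z) (h : a ≤ b - z) :
    b⁻¹ * (1 + z * b⁻¹) ≤ a⁻¹ := by
  have hb : 0 < b := by linarith
  have h1 : b⁻¹ * (1 + z * b⁻¹) = (b + z) / b ^ 2 := by field_simp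
  rw [h1, inv_eq_one_div, div_le_div_iff₀ (by positivity) ha]
  nlinarith [mul_le_mul_of_nonneg_left h (by linarith : 0 ≤ b + z), sq_nonneg z]

lemma tilt_succ_add_le (hp0 : 0 ≤ p) (hp1 : p ≤ 1) {m r : ℕ} (hm : 2 ≤ m) (hr : m ≤ r) :
    tilt (1 - p / 2) m (r + 1) +
      ((2 - p) * (Real.exp (tilt (1 - p / 2) m (r + 1)) - 1) +
        (Real.exp (tilt (1 - p / 2) m (r + 1)) - 1) ^ 2) / (2 * r) ≤ tilt (1 - p / 2) m r := by
  set α := 1 - p / 2 with hα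
  have hα0 : 0 ≤ α := by linarith
  have hα1 : α ≤ 1 := by linarith
  have hm' : (2 : ℝ) ≤ m := by exact_mod_cast hm
  have hr' : (m : ℝ) ≤ r := by exact_mod_cast hr
  have hr0 : (0 : ℝ) < r := by linarith
  have ha1 := one_le_ratio_rpow hα0 hm hr
  have hb1 := one_le_ratio_rpow hα0 hm (hr.trans r.le_succ)
  set a := (((r : ℝ) - 1) / ((m : ℝ) - 1)) ^ α with ha
  set b := ((((r + 1 : ℕ) : ℝ) - 1) / ((m : ℝ) - 1)) ^ α with hb
  have hab : a ≤ b * (1 - α / r) := by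
    have hinv : (r : ℝ)⁻¹ ≤ 1 := inv_le_one_of_one_le₀ (by linarith)
    have h1 : a = b * (1 + -(r : ℝ)⁻¹) ^ α := by
      rw [ha, hb, ← Real.mul_rpow]
      · congr 1
        push_cast
        field_simp
        ring
      · exact div_nonneg (by push_cast; linarith) (by linarith)
      · linarith
    rw [h1]
    refine mul_le_mul_of_nonneg_left ?_ (by linarith)
    refine (rpow_one_add_le_one_add_mul_self (by linarith) hα0 hα1).trans_eq ?_
    ring
  have htb : tilt α m (r + 1) = (6 * b - 5)⁻¹ := rfl
  have hta : tilt α m r = (6 * a - 5)⁻¹ := rfl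
  rw [htb, hta]
  set l := (6 * b - 5)⁻¹ with hl
  have hl0 : 0 ≤ l := inv_nonneg.2 (by linarith)
  have hl1 : l ≤ 1 := inv_le_one_of_one_le₀ (by linarith)
  have hlb : l * (6 * b - 5) = 1 := inv_mul_cancel₀ (by linarith)
  calc _ = l + ((2 - p) * (Real.exp l - 1) + (Real.exp l - 1) ^ 2) / 2 / r := by
        rw [div_div]
    _ ≤ l + α * (l * (1 + 5 * l)) / r := by
        gcongr
        exact drift_le hp1 hl0 hl1
    _ = l * (1 + α * (6 * b) / r * l) := by
        have : 1 + 5 * l = 6 * b * l := by linarith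
        rw [this]; ring
    _ ≤ (6 * a - 5)⁻¹ := by
        refine inv_mul_one_add_le_inv (by linarith) (by positivity) ?_
        have : α * (6 * b) / r = 6 * (b * (α / r)) := by ring
        linarith

lemma integral_exp_tilt_le (hp0 : 0 ≤ p) (hp1 : p ≤ 1) {m r v : ℕ} (hm : 2 ≤ m) (hr : m ≤ r)
    (hv : ∀ ω, P.deg m v ω ≤ 4) :
    ∫ ω, Real.exp (tilt (1 - p / 2) m r * (max (P.deg r v ω) 1 : ℕ)) ∂P.μ ≤ Real.exp 4 := by
  induction r, hr using Nat.le_induction with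
  | base =>
    have hm' : (2 : ℝ) ≤ m := by exact_mod_cast hm
    have h1 : tilt (1 - p / 2) m m = 1 := by
      rw [tilt, div_self (by linarith), Real.one_rpow]; norm_num
    calc _ ≤ ∫ _, Real.exp 4 ∂P.μ := by
          refine integral_mono (P.integrable_exp_mul_max_deg m v (by rw [h1]; exact zero_le_one))
            (integrable_const _) fun ω => ?_
          simp only [h1, one_mul, Real.exp_le_exp]
          have := hv ω
          exact_mod_cast (by omega : max (P.deg m v ω) 1 ≤ 4)
      _ = Real.exp 4 := by simp
  | succ r hr ih =>
    refine (P.integral_exp_max_deg_succ_le hp0 hp1 (by omega) v ?_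
      (tilt_succ_add_le hp0 hp1 hm hr)).trans ih
    have := one_le_ratio_rpow (by linarith : 0 ≤ 1 - p / 2) hm (hr.trans r.le_succ)
    exact inv_nonneg.2 (by linarith)

lemma measureReal_le_deg (hp0 : 0 ≤ p) (hp1 : p ≤ 1) {m r v : ℕ} (hm : 2 ≤ m) (hr : m ≤ r)
    (hv : ∀ ω, P.deg m v ω ≤ 4) (x : ℝ) :
    P.μ.real {ω | x ≤ P.deg r v ω} ≤ Real.exp (4 - tilt (1 - p / 2) m r * x) := by
  have hl : 0 ≤ tilt (1 - p / 2) m r := by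
    have := one_le_ratio_rpow (by linarith : 0 ≤ 1 - p / 2) hm hr
    exact inv_nonneg.2 (by linarith)
  set l := tilt (1 - p / 2) m r
  have h1 := mul_meas_ge_le_integral_of_nonneg (μ := P.μ)
    (f := fun ω => Real.exp (l * (max (P.deg r v ω) 1 : ℕ)))
    (ae_of_all _ fun ω => (Real.exp_pos _).le) (P.integrable_exp_mul_max_deg r v hl)
    (Real.exp (l * x))
  rw [Real.exp_sub, le_div_iff₀ (Real.exp_pos _), mul_comm]
  refine le_trans ?_ (h1.trans (P.integral_exp_tilt_le hp0 hp1 hm hr hv))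
  refine mul_le_mul_of_nonneg_left (measureReal_mono fun ω hω => ?_) (Real.exp_pos _).le
  refine Real.exp_le_exp.2 (mul_le_mul_of_nonneg_left (le_trans hω ?_) hl)
  exact_mod_cast le_max_left _ _

/-- With high probability the degree of `v` at time `s` is at most of order
`log t * (s / v) ^ (1 - p / 2)`. -/
lemma measureReal_lt_deg_le (hp0 : 0 ≤ p) (hp1 : p ≤ 1) {s t v : ℕ} (ht : 2 ≤ t) (hv : 1 ≤ v) :
    P.μ.real {ω | 120 * Real.log t * (((s + 1 : ℕ) : ℝ) / v) ^ (1 - p / 2) < P.deg s v ω} ≤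
      Real.exp 4 * (t : ℝ) ^ (-(10 : ℝ)) := by
  have hα0 : 0 ≤ 1 - p / 2 := by linarith
  have hα1 : 1 - p / 2 ≤ 1 := by linarith
  have ht0 : (0 : ℝ) < t := by positivity
  have hlog : 1 / 2 ≤ Real.log t := by
    have h2 : Real.log 2 ≤ Real.log t := Real.log_le_log (by norm_num) (by exact_mod_cast ht)
    linarith [Real.log_two_gt_d9]
  by_cases hs : max v 2 ≤ s
  · set m := max v 2 with hm
    have hm2 : 2 ≤ m := le_max_right _ _
    have hdeg (ω : P.Ω) : P.deg m v ω ≤ 4 := by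
      obtain rfl | hv2 := hv.eq_or_lt
      · exact P.deg_le 2 1 ω
      · obtain ⟨w, rfl⟩ : ∃ w, v = w + 1 := ⟨v - 1, by omega⟩
        rw [hm, max_eq_left hv2, P.deg_succ, P.deg_eq_zero_of_lt ω w.lt_succ_self]
        split_ifs <;> omega
    have hρ1 := one_le_ratio_rpow hα0 hm2 hs
    set ρ := (((s : ℝ) - 1) / ((m : ℝ) - 1)) ^ (1 - p / 2) with hρ
    have hm' : (2 : ℝ) ≤ m := by exact_mod_cast hm2
    have hs' : (m : ℝ) ≤ s := by exact_mod_cast hs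
    have hvm : (v : ℝ) ≤ m := by exact_mod_cast le_max_left _ _
    have hv0 : (0 : ℝ) < v := by positivity
    have hρle : ρ ≤ 2 * (((s + 1 : ℕ) : ℝ) / v) ^ (1 - p / 2) := by
      calc ρ ≤ (2 * (((s + 1 : ℕ) : ℝ) / v)) ^ (1 - p / 2) := by
            refine Real.rpow_le_rpow (div_nonneg (by linarith) (by linarith)) ?_ hα0
            rw [← mul_div_assoc, div_le_div_iff₀ (by linarith) hv0]
            push_cast
            nlinarith
        _ = 2 ^ (1 - p / 2) * (((s + 1 : ℕ) : ℝ) / v) ^ (1 - p / 2) :=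
            Real.mul_rpow (by norm_num) (by positivity)
        _ ≤ 2 * (((s + 1 : ℕ) : ℝ) / v) ^ (1 - p / 2) := by
            gcongr
            exact Real.rpow_le_self_of_one_le (by norm_num) hα1
    calc _ ≤ P.μ.real {ω | 60 * Real.log t * ρ ≤ P.deg s v ω} := by
          refine measureReal_mono fun ω hω => ?_
          refine le_trans ?_ (le_of_lt (Set.mem_ofPred_eq ▸ hω))
          nlinarith
      _ ≤ Real.exp (4 - tilt (1 - p / 2) m s * (60 * Real.log t * ρ)) :=
          P.measureReal_le_deg hp0 hp1 hm2 hs hdeg _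
      _ ≤ Real.exp (4 + -(10 * Real.log t)) := by
          rw [Real.exp_le_exp]
          have htilt : tilt (1 - p / 2) m s * (6 * ρ - 5) = 1 :=
            inv_mul_cancel₀ (by rw [← hρ]; linarith)
          have htilt0 : 0 ≤ tilt (1 - p / 2) m s := inv_nonneg.2 (by rw [← hρ]; linarith)
          have : 1 ≤ tilt (1 - p / 2) m s * (6 * ρ) := by linarith
          nlinarith
      _ = Real.exp 4 * (t : ℝ) ^ (-(10 : ℝ)) := by
          rw [Real.exp_add, Real.rpow_def_of_pos ht0]
          ring_nf
  · have hempty : {ω | 120 * Real.log t * (((s + 1 : ℕ) : ℝ) / v) ^ (1 - p / 2) <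
        P.deg s v ω} = ∅ := by
      refine Set.eq_empty_of_forall_notMem fun ω hω => ?_
      refine absurd (Set.mem_ofPred_eq ▸ hω) (not_lt.2 ?_)
      by_cases hsv : s < v
      · rw [P.deg_eq_zero_of_lt ω hsv, Nat.cast_zero]
        have : 0 ≤ Real.log t := by linarith
        positivity
      · obtain ⟨rfl, rfl⟩ : v = 1 ∧ s = 1 := by omega
        have h1 : (1 : ℝ) ≤ (((1 + 1 : ℕ) : ℝ) / (1 : ℕ)) ^ (1 - p / 2) :=
          Real.one_le_rpow (by norm_num) hα0
        have h2 : (P.deg 1 1 ω : ℝ) ≤ 2 := by exact_mod_cast P.deg_le 1 1 ω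
        nlinarith
    rw [hempty, measureReal_empty]
    positivity

/-- At step `s + 1` an edge joining `u` and `w` is added by an edge-step, while the degrees of `u`
and `w` in `G_s` are at most `a` and `b`. -/
def boundedEdge (s u w : ℕ) (a b : ℝ) : Set P.Ω :=
  {ω | P.EdgeStepEdge (s + 1) u w ω ∧ P.deg s u ω ≤ a ∧ P.deg s w ω ≤ b}

lemma measurableSet_deg_le (s v : ℕ) (a : ℝ) : MeasurableSet[P.ℱ s] {ω | (P.deg s v ω : ℝ) ≤ a} :=
  P.measurable_deg s v (MeasurableSet.of_discrete (s := {n : ℕ | (n : ℝ) ≤ a}))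

lemma measurableSet_boundedEdge (s u w : ℕ) (a b : ℝ) :
    MeasurableSet[P.ℱ (s + 1)] (P.boundedEdge s u w a b) := by
  have hE : MeasurableSet[P.ℱ (s + 1)] {ω | P.EdgeStepEdge (s + 1) u w ω} :=
    (MeasurableSet.const _).inter ((P.Z_meas (s + 1) (MeasurableSet.singleton false)).inter
      ((P.ep_meas (s + 1) (MeasurableSet.singleton (u, w))).union
        (P.ep_meas (s + 1) (MeasurableSet.singleton (w, u)))))
  exact hE.inter (P.ℱ.mono s.le_succ _
    ((P.measurableSet_deg_le s u a).inter (P.measurableSet_deg_le s w b)))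

lemma measureReal_inter_edgeEvent_le (hp0 : 0 ≤ p) (hp1 : p ≤ 1) {s : ℕ} (hs : 1 ≤ s)
    (q : ℕ × ℕ) {a b : ℝ} {H : Set P.Ω} (hH : MeasurableSet[P.ℱ s] H)
    (ha : ∀ ω ∈ H, P.deg s q.1 ω ≤ a) (hb : ∀ ω ∈ H, P.deg s q.2 ω ≤ b) :
    P.μ.real (H ∩ {ω | P.Z (s + 1) ω = false ∧ P.ep (s + 1) ω = q}) ≤
      P.μ.real H * (a * b / ((s + 1 : ℕ) : ℝ) ^ 2) := by
  have hE := P.ℱ.le _ _ (P.measurableSet_edgeEvent (s + 1) q)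
  have hH' := P.ℱ.le _ _ hH
  set E := {ω | P.Z (s + 1) ω = false ∧ P.ep (s + 1) ω = q}
  have hs1 : (1 : ℝ) ≤ s := by exact_mod_cast hs
  have hp1' : 0 ≤ 1 - p := by linarith
  calc P.μ.real (H ∩ E)
      = ∫ ω, H.indicator (fun _ => (1 : ℝ)) ω * E.indicator (fun _ => (1 : ℝ)) ω ∂P.μ := by
        rw [← integral_indicator_one (hH'.inter hE), Set.inter_indicator_one]
        rfl
    _ = ∫ ω, H.indicator (fun _ => (1 : ℝ)) ω *
          ((1 - p) * P.deg s q.1 ω * P.deg s q.2 ω / (2 * s) ^ 2) ∂P.μ :=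
        P.integral_mul_edgeEvent hs q (stronglyMeasurable_const.indicator hH) (C := 1) fun ω => by
          by_cases h : ω ∈ H <;> simp [h]
    _ ≤ ∫ ω, H.indicator (fun _ => (1 : ℝ)) ω * (a * b / ((s + 1 : ℕ) : ℝ) ^ 2) ∂P.μ := by
        refine integral_mono_of_nonneg (ae_of_all _ fun ω => ?_)
          (((integrable_const 1).indicator hH').mul_const _) (ae_of_all _ fun ω => ?_)
        · exact mul_nonneg (Set.indicator_nonneg (fun _ _ => zero_le_one) _) (by positivity)
        · by_cases h : ω ∈ H
          · simp only [Set.indicator_of_mem h, one_mul]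
            have h1 := ha ω h
            have h2 := hb ω h
            have ha0 : 0 ≤ a := (Nat.cast_nonneg _).trans h1
            calc (1 - p) * P.deg s q.1 ω * P.deg s q.2 ω / (2 * s) ^ 2
                ≤ 1 * a * b / (2 * s) ^ 2 := by
                  gcongr
                  linarith
              _ ≤ a * b / ((s + 1 : ℕ) : ℝ) ^ 2 := by
                  have hb0 : 0 ≤ b := (Nat.cast_nonneg _).trans h2
                  rw [one_mul]
                  gcongr
                  push_cast
                  linarith
          · simp [h]
    _ = P.μ.real H * (a * b / ((s + 1 : ℕ) : ℝ) ^ 2) := by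
        rw [integral_mul_const]
        congr 1
        exact integral_indicator_one hH'

lemma measureReal_inter_boundedEdge_le (hp0 : 0 ≤ p) (hp1 : p ≤ 1) {s : ℕ} (hs : 1 ≤ s)
    (u w : ℕ) (a b : ℝ) {H : Set P.Ω} (hH : MeasurableSet[P.ℱ s] H) (ha : 0 ≤ a) (hb : 0 ≤ b) :
    P.μ.real (H ∩ P.boundedEdge s u w a b) ≤
      P.μ.real H * (2 * (a * b) / ((s + 1 : ℕ) : ℝ) ^ 2) := by
  set H' := H ∩ ({ω | (P.deg s u ω : ℝ) ≤ a} ∩ {ω | (P.deg s w ω : ℝ) ≤ b})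
  have hH' : MeasurableSet[P.ℱ s] H' :=
    hH.inter ((P.measurableSet_deg_le s u a).inter (P.measurableSet_deg_le s w b))
  have h1 := P.measureReal_inter_edgeEvent_le hp0 hp1 hs (u, w) hH'
    (fun ω h => h.2.1) (fun ω h => h.2.2)
  have h2 := P.measureReal_inter_edgeEvent_le hp0 hp1 hs (w, u) hH'
    (fun ω h => h.2.2) (fun ω h => h.2.1)
  have hsub : H ∩ P.boundedEdge s u w a b ⊆
      (H' ∩ {ω | P.Z (s + 1) ω = false ∧ P.ep (s + 1) ω = (u, w)}) ∪
        (H' ∩ {ω | P.Z (s + 1) ω = false ∧ P.ep (s + 1) ω = (w, u)}) := by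
    rintro ω ⟨hω, ⟨-, hZ, hep⟩, hu, hw⟩
    rcases hep with hep | hep
    · exact Or.inl ⟨⟨hω, hu, hw⟩, hZ, hep⟩
    · exact Or.inr ⟨⟨hω, hu, hw⟩, hZ, hep⟩
  calc _ ≤ P.μ.real H' * (a * b / ((s + 1 : ℕ) : ℝ) ^ 2) +
        P.μ.real H' * (b * a / ((s + 1 : ℕ) : ℝ) ^ 2) :=
        (measureReal_mono hsub).trans ((measureReal_union_le _ _).trans (add_le_add h1 h2))
    _ = P.μ.real H' * (2 * (a * b) / ((s + 1 : ℕ) : ℝ) ^ 2) := by ring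
    _ ≤ _ := by
        exact mul_le_mul_of_nonneg_right (measureReal_mono Set.inter_subset_left) (by positivity)

/-- The bound for three bounded edges added at increasing times. -/
lemma measureReal_three_boundedEdge_le (hp0 : 0 ≤ p) (hp1 : p ≤ 1) {s : Fin 3 → ℕ}
    (hs : 1 ≤ s 0) (h01 : s 0 < s 1) (h12 : s 1 < s 2) (u w : Fin 3 → ℕ) (a b : Fin 3 → ℝ)
    (ha : ∀ n, 0 ≤ a n) (hb : ∀ n, 0 ≤ b n) :
    P.μ.real (⋂ n, P.boundedEdge (s n) (u n) (w n) (a n) (b n)) ≤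
      ∏ n, 2 * (a n * b n) / ((s n + 1 : ℕ) : ℝ) ^ 2 := by
  set X := fun n => P.boundedEdge (s n) (u n) (w n) (a n) (b n)
  have hX (n : Fin 3) {r : ℕ} (hr : s n < r) : MeasurableSet[P.ℱ r] (X n) :=
    P.ℱ.mono hr _ (P.measurableSet_boundedEdge _ _ _ _ _)
  have hc (n : Fin 3) : 0 ≤ 2 * (a n * b n) / ((s n + 1 : ℕ) : ℝ) ^ 2 := by
    have := ha n
    have := hb n
    positivity
  have step (n : Fin 3) (hn : 1 ≤ s n) {H : Set P.Ω} (hH : MeasurableSet[P.ℱ (s n)] H) :=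
    P.measureReal_inter_boundedEdge_le hp0 hp1 hn (u n) (w n) (a n) (b n) hH (ha n) (hb n)
  have h0 := step 0 hs MeasurableSet.univ
  rw [probReal_univ, one_mul] at h0
  have h1 := step 1 (by omega) (MeasurableSet.univ.inter (hX 0 h01))
  have h2 := step 2 (by omega)
    ((MeasurableSet.univ.inter (hX 0 (h01.trans h12))).inter (hX 1 h12))
  rw [Fin.prod_univ_three]
  calc P.μ.real (⋂ n, X n) ≤ P.μ.real (Set.univ ∩ X 0 ∩ X 1 ∩ X 2) :=
        measureReal_mono fun ω hω => by
          rw [Set.mem_iInter] at hω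
          exact ⟨⟨⟨trivial, hω 0⟩, hω 1⟩, hω 2⟩
    _ ≤ _ := h2.trans (mul_le_mul_of_nonneg_right
        (h1.trans (mul_le_mul_of_nonneg_right h0 (hc 1))) (hc 2))

/-- The bound for three bounded edges added at distinct times. -/
lemma measureReal_iInter_boundedEdge_le (hp0 : 0 ≤ p) (hp1 : p ≤ 1) {s : Fin 3 → ℕ}
    (hs : ∀ n, 1 ≤ s n) (hinj : Function.Injective s) (u w : Fin 3 → ℕ) (a b : Fin 3 → ℝ)
    (ha : ∀ n, 0 ≤ a n) (hb : ∀ n, 0 ≤ b n) :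
    P.μ.real (⋂ n, P.boundedEdge (s n) (u n) (w n) (a n) (b n)) ≤
      ∏ n, 2 * (a n * b n) / ((s n + 1 : ℕ) : ℝ) ^ 2 := by
  set σ := Tuple.sort s
  have hmono : StrictMono (s ∘ σ) :=
    (Tuple.monotone_sort s).strictMono_of_injective (hinj.comp σ.injective)
  have h := P.measureReal_three_boundedEdge_le hp0 hp1 (s := s ∘ σ) (hs _)
    (hmono (by decide)) (hmono (by decide)) (u ∘ σ) (w ∘ σ) (a ∘ σ) (b ∘ σ)
    (fun _ => ha _) (fun _ => hb _)
  rw [← Equiv.prod_comp σ]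
  refine le_trans (measureReal_mono fun ω hω => ?_) h
  rw [Set.mem_iInter] at hω ⊢
  exact fun n => hω (σ n)

lemma edgeStepEdge_eq_pair {s u w u' w' : ℕ} {ω : P.Ω} (h : P.EdgeStepEdge s u w ω)
    (h' : P.EdgeStepEdge s u' w' ω) : (u = u' ∧ w = w') ∨ (u = w' ∧ w = u') := by
  obtain ⟨-, -, h | h⟩ := h <;> obtain ⟨-, -, h' | h'⟩ := h' <;>
    · rw [h, Prod.mk.injEq] at h'
      tauto

end PAProcess

lemma edge_bound_rpow_eq {L : ℝ} {p : ℝ} {s u w : ℕ} (hs : 1 ≤ s) (hu : 1 ≤ u) (hw : 1 ≤ w) :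
    2 * ((L * ((s : ℝ) / u) ^ (1 - p / 2)) * (L * ((s : ℝ) / w) ^ (1 - p / 2))) / (s : ℝ) ^ 2 =
      2 * L ^ 2 * (s : ℝ) ^ (-p) * ((u : ℝ) ^ (-(1 - p / 2)) * (w : ℝ) ^ (-(1 - p / 2))) := by
  have hs0 : (0 : ℝ) < s := by positivity
  have hu0 : (0 : ℝ) < u := by positivity
  have hw0 : (0 : ℝ) < w := by positivity
  have h : (s : ℝ) ^ (-p) = (s : ℝ) ^ (1 - p / 2) * (s : ℝ) ^ (1 - p / 2) / (s : ℝ) ^ 2 := by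
    rw [← Real.rpow_add hs0, ← Real.rpow_two, ← Real.rpow_sub hs0]
    ring_nf
  rw [h, Real.div_rpow hs0.le hu0.le, Real.div_rpow hs0.le hw0.le, Real.rpow_neg hu0.le,
    Real.rpow_neg hw0.le]
  ring


/-- For `p ∈ (0,1)` there is `C > 0` (depending only on `p`) such that for all `t ≥ 2`, all
`1 ≤ i < j < k ≤ t` and all times `s₁, s₂, s₃ ≤ t`,
`E[g^{i,j}_{s₁} g^{i,k}_{s₂} g^{j,k}_{s₃}] ≤
  C (log t)⁶ (ijk)^{-(2-p)} (s₁s₂s₃)^{-p} + C t^{-10}`. -/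
theorem triple_edge_step_product_bound (p : ℝ) (hp0 : 0 < p) (hp1 : p < 1)
    (P : PAProcess p) :
    ∃ C : ℝ, 0 < C ∧
      ∀ t : ℕ, 2 ≤ t → ∀ i j k s₁ s₂ s₃ : ℕ,
        1 ≤ i → i < j → j < k → k ≤ t →
        1 ≤ s₁ → s₁ ≤ t → 1 ≤ s₂ → s₂ ≤ t → 1 ≤ s₃ → s₃ ≤ t →
        (P.μ {ω | P.EdgeStepEdge s₁ i j ω ∧ P.EdgeStepEdge s₂ i k ω ∧
            P.EdgeStepEdge s₃ j k ω}).toReal ≤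
          C * Real.log t ^ 6 * ((i : ℝ) * j * k) ^ (-(2 - p)) *
              ((s₁ : ℝ) * s₂ * s₃) ^ (-p) +
            C * (t : ℝ) ^ (-(10 : ℝ)) := by
  have hp0' := hp0.le
  have hp1' := hp1.le
  refine ⟨8 * 120 ^ 6 + 6 * Real.exp 4, by positivity, ?_⟩
  intro t ht i j k s₁ s₂ s₃ hi hij hjk hkt h1 _ h2 _ h3 _
  set S := {ω | P.EdgeStepEdge s₁ i j ω ∧ P.EdgeStepEdge s₂ i k ω ∧ P.EdgeStepEdge s₃ j k ω}
  change P.μ.real S ≤ _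
  have hlog : 0 ≤ Real.log t := Real.log_natCast_nonneg t
  obtain hS | ⟨ω₀, hω₀⟩ := S.eq_empty_or_nonempty
  · rw [hS, measureReal_empty]
    positivity
  set s : Fin 3 → ℕ := ![s₁ - 1, s₂ - 1, s₃ - 1] with hs_def
  set u : Fin 3 → ℕ := ![i, i, j] with hu_def
  set w : Fin 3 → ℕ := ![j, k, k] with hw_def
  have hs1 : s₁ - 1 + 1 = s₁ := by omega
  have hs2 : s₂ - 1 + 1 = s₂ := by omega
  have hs3 : s₃ - 1 + 1 = s₃ := by omega
  have hs : ∀ n, 1 ≤ s n := by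
    have := hω₀.1.1
    have := hω₀.2.1.1
    have := hω₀.2.2.1
    intro n
    fin_cases n <;> simp [hs_def] <;> omega
  have hinj : Function.Injective s := by
    have h12 : s₁ ≠ s₂ := by
      rintro rfl
      have := P.edgeStepEdge_eq_pair hω₀.1 hω₀.2.1
      omega
    have h13 : s₁ ≠ s₃ := by
      rintro rfl
      have := P.edgeStepEdge_eq_pair hω₀.1 hω₀.2.2
      omega
    have h23 : s₂ ≠ s₃ := by
      rintro rfl
      have := P.edgeStepEdge_eq_pair hω₀.2.1 hω₀.2.2
      omega
    intro m n h
    fin_cases m <;> fin_cases n <;> simp [hs_def] at h ⊢ <;> omega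
  have hu : ∀ n, 1 ≤ u n := by intro n; fin_cases n <;> simp [hu_def] <;> omega
  have hw : ∀ n, 1 ≤ w n := by intro n; fin_cases n <;> simp [hw_def] <;> omega
  set b : ℕ → ℕ → ℝ := fun r v => 120 * Real.log t * (((r + 1 : ℕ) : ℝ) / v) ^ (1 - p / 2)
  have hb (r v : ℕ) : 0 ≤ b r v := by positivity
  have hmain := P.measureReal_iInter_boundedEdge_le hp0' hp1' hs hinj u w
    (fun n => b (s n) (u n)) (fun n => b (s n) (w n)) (fun _ => hb _ _) (fun _ => hb _ _)
  have hprod : ∏ n, 2 * (b (s n) (u n) * b (s n) (w n)) / ((s n + 1 : ℕ) : ℝ) ^ 2 =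
      8 * 120 ^ 6 * Real.log t ^ 6 * ((i : ℝ) * j * k) ^ (-(2 - p)) *
        ((s₁ : ℝ) * s₂ * s₃) ^ (-p) := by
    have hsq (x : ℕ) : (x : ℝ) ^ (-(2 - p)) = ((x : ℝ) ^ (-(1 - p / 2))) ^ 2 := by
      rw [← Real.rpow_natCast, ← Real.rpow_mul (Nat.cast_nonneg x)]
      congr 1
      push_cast
      ring
    simp only [b]
    rw [Finset.prod_congr rfl fun n _ => edge_bound_rpow_eq (L := 120 * Real.log t) (p := p)
      (Nat.le_add_left 1 (s n)) (hu n) (hw n), Fin.prod_univ_three]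
    simp only [hs_def, hu_def, hw_def, Matrix.cons_val]
    rw [hs1, hs2, hs3, Real.mul_rpow (by positivity) (by positivity),
      Real.mul_rpow (by positivity) (by positivity), Real.mul_rpow (by positivity) (by positivity),
      Real.mul_rpow (by positivity) (by positivity), hsq, hsq, hsq]
    ring
  set B : ℕ → ℕ → Set P.Ω := fun r v => {ω | b r v < P.deg r v ω}
  have hB (r : ℕ) {v : ℕ} (hv : 1 ≤ v) : P.μ.real (B r v) ≤ Real.exp 4 * (t : ℝ) ^ (-(10 : ℝ)) :=
    P.measureReal_lt_deg_le hp0' hp1' ht hv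
  have hsub : S ⊆ (⋂ n, P.boundedEdge (s n) (u n) (w n) (b (s n) (u n)) (b (s n) (w n))) ∪
      ⋃ n, (B (s n) (u n) ∪ B (s n) (w n)) := by
    intro ω hω
    by_cases hbad : ω ∈ ⋃ n, (B (s n) (u n) ∪ B (s n) (w n))
    · exact Or.inr hbad
    · refine Or.inl (Set.mem_iInter.2 fun n => ?_)
      have hE : P.EdgeStepEdge (s n + 1) (u n) (w n) ω := by
        fin_cases n
        · simpa [hs_def, hu_def, hw_def, hs1] using hω.1
        · simpa [hs_def, hu_def, hw_def, hs2] using hω.2.1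
        · simpa [hs_def, hu_def, hw_def, hs3] using hω.2.2
      refine ⟨hE, not_lt.1 fun h => hbad ?_, not_lt.1 fun h => hbad ?_⟩
      · exact Set.mem_iUnion.2 ⟨n, Or.inl h⟩
      · exact Set.mem_iUnion.2 ⟨n, Or.inr h⟩
  have hbad : P.μ.real (⋃ n, (B (s n) (u n) ∪ B (s n) (w n))) ≤
      6 * Real.exp 4 * (t : ℝ) ^ (-(10 : ℝ)) := by
    calc _ ≤ ∑ n, P.μ.real (B (s n) (u n) ∪ B (s n) (w n)) := measureReal_iUnion_fintype_le _
      _ ≤ ∑ _n : Fin 3, 2 * (Real.exp 4 * (t : ℝ) ^ (-(10 : ℝ))) :=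
          Finset.sum_le_sum fun n _ => (measureReal_union_le _ _).trans
            ((add_le_add (hB (s n) (hu n)) (hB (s n) (hw n))).trans_eq (two_mul _).symm)
      _ = _ := by
          rw [Finset.sum_const, Finset.card_univ, Fintype.card_fin, nsmul_eq_mul]
          push_cast
          ring
  have htotal := (measureReal_mono hsub).trans
    ((measureReal_union_le _ _).trans (add_le_add (hmain.trans_eq hprod) hbad))
  have hX : 0 ≤ Real.log t ^ 6 * ((i : ℝ) * j * k) ^ (-(2 - p)) * ((s₁ : ℝ) * s₂ * s₃) ^ (-p) := by
    positivity
  have hY : 0 ≤ (t : ℝ) ^ (-(10 : ℝ)) := by positivity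
  nlinarith [mul_nonneg (Real.exp_pos 4).le hX]
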